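/- (Sufficiency of p−1 single-node interventions.) For every p ≥ 1 there exist p−1 singleton target sets T_1, …, T_{p−1} ⊆ Fin p (together with the empty observational target T_0 = ∅) such that for all DAGs G and G' on Fin p: if the I-DAGs of (G; T_0,…,T_{p−1}) and (G'; T_0,…,T_{p−1}) are Markov equivalent, then G = G'. -/

import Mathlib

namespace CausalDiscovery

variable {V : Type*}

/-- A relation is acyclic if it has no directed cycles. -/
def Acyclic (E : V → V → Prop) : Prop :=
  ∀ v, ¬ Relation.TransGen E v v

/-- `i` and `j` are adjacent (joined by an edge in either direction). -/
def Adj (E : V → V → Prop) (i j : V) : Prop :=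
  E i j ∨ E j i

/-- `j` is a descendant of `i`, i.e. reachable from `i` by a directed path. -/
def Desc (E : V → V → Prop) (i j : V) : Prop :=
  Relation.ReflTransGen E i j

/-- `f 0, f 1, …, f n` is a path between `i` and `j`: the vertices are distinct and
consecutive vertices are adjacent. -/
def IsPath (E : V → V → Prop) (n : ℕ) (f : ℕ → V) (i j : V) : Prop :=
  0 < n ∧ f 0 = i ∧ f n = j ∧
    (∀ s t, s ≤ n → t ≤ n → f s = f t → s = t) ∧
    ∀ t, t < n → Adj E (f t) (f (t + 1))

/-- The vertex at (interior) position `t` of the path `f` is a collider: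
both edges of the path at that vertex point into it. -/
def ColliderAt (E : V → V → Prop) (f : ℕ → V) (t : ℕ) : Prop :=
  E (f (t - 1)) (f t) ∧ E (f (t + 1)) (f t)

/-- The path `f 0, …, f n` d-connects its endpoints given `C`: every non-collider
interior vertex is outside `C`, every collider is in `C` or has a descendant in `C`. -/
def DConn (E : V → V → Prop) (n : ℕ) (f : ℕ → V) (C : Finset V) : Prop :=
  ∀ t, 0 < t → t < n →
    (ColliderAt E f t → f t ∈ C ∨ ∃ d ∈ C, Desc E (f t) d) ∧
    (¬ ColliderAt E f t → f t ∉ C)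

/-- `i` and `j` are d-separated given `C`: no path between them d-connects given `C`. -/
def DSep (E : V → V → Prop) (i j : V) (C : Finset V) : Prop :=
  ∀ n f, IsPath E n f i j → ¬ DConn E n f C

/-- The independence model `I(E)`: all d-separation triples `(i, j, C)` with `i, j`
distinct and `C ⊆ V \ {i, j}`. -/
def Indep (E : V → V → Prop) : Set (V × V × Finset V) :=
  {x | x.1 ≠ x.2.1 ∧ x.1 ∉ x.2.2 ∧ x.2.1 ∉ x.2.2 ∧ DSep E x.1 x.2.1 x.2.2}

/-- Two graphs are Markov equivalent if they have the same independence model. -/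
def MarkovEquiv (E E' : V → V → Prop) : Prop :=
  Indep E = Indep E'

/-- Two graphs have the same skeleton if they have the same adjacencies. -/
def SameSkeleton (E E' : V → V → Prop) : Prop :=
  ∀ i j, Adj E i j ↔ Adj E' i j

/-- The v-structures of a graph: triples `(i, j, k)` with `i → j ← k` and `i, k`
not adjacent. -/
def VStruct (E : V → V → Prop) : Set (V × V × V) :=
  {x | E x.1 x.2.1 ∧ E x.2.2 x.2.1 ∧ x.1 ≠ x.2.2 ∧ ¬ Adj E x.1 x.2.2}


/-- The edge relation of the I-DAG of `(E; T)`: the vertex set is `Fin p ⊕ Fin M`,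
the edges are the edges of `E` together with an edge `ζ_m → i` for every `m` and
every `i ∈ T m`. -/
def IDagEdge {p M : ℕ} (E : Fin p → Fin p → Prop) (T : Fin M → Finset (Fin p)) :
    Fin p ⊕ Fin M → Fin p ⊕ Fin M → Prop
  | Sum.inl i, Sum.inl j => E i j
  | Sum.inr m, Sum.inl i => i ∈ T m
  | _, _ => False

/-- The parents of a vertex. -/
noncomputable def parents [Fintype V] (E : V → V → Prop) (j : V) : Finset V :=
  open Classical in Finset.univ.filter fun v => E v j

theorem mem_parents [Fintype V] {E : V → V → Prop} {v j : V} : v ∈ parents E j ↔ E v j := by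
  simp [parents]

/-- In a DAG, the parents of `j` d-separate `j` from every non-adjacent non-descendant. -/
theorem parents_mem_indep [Fintype V] {E : V → V → Prop} (hE : Acyclic E) {i j : V}
    (hadj : ¬ Adj E i j) (hdesc : ¬ Desc E j i) : (j, i, parents E j) ∈ Indep E := by
  refine ⟨?_, ?_, ?_, ?_⟩
  · intro (hji : j = i)
    exact hdesc (hji ▸ Relation.ReflTransGen.refl)
  · exact fun h => hE j (.single (mem_parents.1 h))
  · exact fun h => hadj (Or.inl (mem_parents.1 h))
  · rintro n f ⟨hn, h0, hfn, -, hpath⟩ hconn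
    dsimp only at h0 hfn hconn
    have directed : ∀ t, t < n → E (f t) (f (t + 1)) ∧ Relation.TransGen E j (f (t + 1)) := by
      intro t
      induction t with
      | zero =>
        intro _
        rcases hpath 0 hn with h | h
        · exact ⟨h, h0 ▸ .single h⟩
        · exfalso
          have h1 : 1 < n := by
            by_contra hlt
            obtain rfl : n = 1 := by omega
            exact hadj (Or.inl (by simpa [h0, hfn] using h))
          refine (hconn 1 one_pos h1).2 (fun hc => ?_) (mem_parents.2 (h0 ▸ h))
          exact hE (f 0) ((Relation.TransGen.single hc.1).tail h)
      | succ t ih =>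
        intro ht
        obtain ⟨hedge, htrans⟩ := ih (by omega)
        rcases hpath (t + 1) ht with h | h
        · exact ⟨h, htrans.tail h⟩
        · exfalso
          rcases (hconn (t + 1) t.succ_pos ht).1 ⟨hedge, h⟩ with hc | ⟨d, hd, hfd⟩
          · exact hE j (htrans.tail (mem_parents.1 hc))
          · exact hE j ((htrans.trans_left hfd).tail (mem_parents.1 hd))
    have hlast := (directed (n - 1) (by omega)).2
    rw [Nat.sub_add_cancel hn, hfn] at hlast
    exact hdesc hlast.to_reflTransGen

/-- Adjacent vertices are never d-separated. -/
theorem Adj.not_dSep {E : V → V → Prop} {i j : V} (h : Adj E i j) (hij : i ≠ j)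
    (C : Finset V) : ¬ DSep E i j C := by
  intro hsep
  refine hsep 1 (fun t => if t = 0 then i else j) ⟨one_pos, rfl, rfl, ?_, ?_⟩ ?_
  · intro s t hs ht hst
    interval_cases s <;> interval_cases t <;> simp_all [eq_comm]
  · intro t ht
    obtain rfl : t = 0 := by omega
    simpa using h
  · intro t ht ht'
    omega

/-- A directed path `i → k → j` d-connects `j` and `i` given any set not containing `k`. -/
theorem not_dSep_of_chain {E : V → V → Prop} (hE : Acyclic E) {i k j : V} (hik : E i k)
    (hkj : E k j) {C : Finset V} (hk : k ∉ C) : ¬ DSep E j i C := by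
  intro hsep
  have hik' : i ≠ k := by rintro rfl; exact hE _ (.single hik)
  have hkj' : k ≠ j := by rintro rfl; exact hE _ (.single hkj)
  have hij' : i ≠ j := by rintro rfl; exact hE _ ((Relation.TransGen.single hik).tail hkj)
  refine hsep 2 (fun t => if t = 0 then j else if t = 1 then k else i)
    ⟨two_pos, rfl, rfl, ?_, ?_⟩ ?_
  · intro s t hs ht hst
    interval_cases s <;> interval_cases t <;> simp_all [eq_comm]
  · intro t ht
    interval_cases t
    · exact Or.inr (by simpa using hkj)
    · exact Or.inr (by simpa using hik)
  · intro t ht ht'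
    obtain rfl : t = 1 := by omega
    refine ⟨fun hc => ?_, fun _ => by simpa using hk⟩
    exact absurd ((Relation.TransGen.single hkj).tail (by simpa using hc.1)) (hE k)

theorem Adj.symm {E : V → V → Prop} {i j : V} (h : Adj E i j) : Adj E j i :=
  Or.symm h

theorem Acyclic.not_desc_or_not_desc {E : V → V → Prop} (hE : Acyclic E) {i j : V}
    (hij : i ≠ j) : ¬ Desc E j i ∨ ¬ Desc E i j := by
  by_contra! h
  rcases Relation.reflTransGen_iff_eq_or_transGen.1 h.1 with rfl | hji
  · exact hij rfl
  · exact hE _ (hji.trans_left h.2)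

theorem MarkovEquiv.adj [Fintype V] {E E' : V → V → Prop} (h : MarkovEquiv E E')
    (hE' : Acyclic E') {i j : V} (hij : i ≠ j) (hadj : Adj E i j) : Adj E' i j := by
  by_contra hadj'
  rcases hE'.not_desc_or_not_desc hij with hd | hd
  · have := parents_mem_indep hE' hadj' hd
    rw [← h] at this
    exact hadj.symm.not_dSep hij.symm _ this.2.2.2
  · have := parents_mem_indep hE' (fun h => hadj' h.symm) hd
    rw [← h] at this
    exact hadj.not_dSep hij _ this.2.2.2

section IDag

variable {p M : ℕ} {G G' : Fin p → Fin p → Prop} {T : Fin M → Finset (Fin p)}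

theorem exists_inl_of_transGen_iDagEdge {a b : Fin p ⊕ Fin M}
    (h : Relation.TransGen (IDagEdge G T) a b) :
    ∃ y, b = Sum.inl y ∧ ∀ x, a = Sum.inl x → Relation.TransGen G x y := by
  induction h with
  | @single b hb =>
    cases b with
    | inl y => exact ⟨y, rfl, by rintro x rfl; exact .single hb⟩
    | inr m => cases a <;> exact hb.elim
  | @tail b c _ hc ih =>
    obtain ⟨y, rfl, hy⟩ := ih
    cases c with
    | inl z => exact ⟨z, rfl, fun x hx => (hy x hx).tail hc⟩
    | inr m => exact hc.elim

theorem Acyclic.iDagEdge (hG : Acyclic G) : Acyclic (IDagEdge G T) := by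
  intro v hv
  obtain ⟨y, rfl, hy⟩ := exists_inl_of_transGen_iDagEdge hv
  exact hG y (hy y rfl)

/-- A single-vertex intervention at `j` fixes the orientation of every edge into `j`. -/
theorem not_reversed_of_target_eq_singleton (hG : Acyclic G) (hG' : Acyclic G')
    (h : MarkovEquiv (IDagEdge G T) (IDagEdge G' T)) {i j : Fin p} {m : Fin M}
    (hT : T m = {j}) (hij : G i j) : ¬ G' j i := by
  intro hji
  have hne : i ≠ j := by rintro rfl; exact hG _ (.single hij)
  have hadj : ¬ Adj (IDagEdge G T) (Sum.inr m) (Sum.inl i) := by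
    rintro (hm | hm)
    · exact hne (by simpa [IDagEdge, hT] using hm)
    · exact hm
  have hdesc : ¬ Desc (IDagEdge G T) (Sum.inl i) (Sum.inr m) := by
    intro hd
    rcases Relation.reflTransGen_iff_eq_or_transGen.1 hd with heq | ht
    · cases heq
    · obtain ⟨y, hy, -⟩ := exists_inl_of_transGen_iDagEdge ht
      cases hy
  have hsep := parents_mem_indep hG.iDagEdge hadj hdesc
  have hj : Sum.inl j ∉ parents (IDagEdge G T) (Sum.inl i) := fun hm =>
    have hji' : G j i := mem_parents (E := IDagEdge G T).1 hm
    hG i ((Relation.TransGen.single hij).tail hji')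
  rw [h] at hsep
  have hmj : IDagEdge G' T (Sum.inr m) (Sum.inl j) := by simp [IDagEdge, hT]
  exact not_dSep_of_chain hG'.iDagEdge hmj (j := Sum.inl i) hji hj hsep.2.2.2

end IDag

/-- **Sufficiency of `p − 1` single-node interventions (Eberhardt et al.).** For
every `p ≥ 1` there are `p − 1` singleton target sets, together with the empty
observational target, such that any two DAGs on `Fin p` with Markov equivalent
I-DAGs are equal. -/
theorem singleton_interventions_sufficient (p : ℕ) (hp : 1 ≤ p) :
    ∃ T : Fin p → Finset (Fin p),
      T ⟨0, hp⟩ = ∅ ∧ (∀ m : Fin p, m ≠ ⟨0, hp⟩ → (T m).card = 1) ∧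
        ∀ G G' : Fin p → Fin p → Prop, Acyclic G → Acyclic G' →
          MarkovEquiv (IDagEdge G T) (IDagEdge G' T) → G = G' := by
  refine ⟨fun m => if m = ⟨0, hp⟩ then ∅ else {m}, by simp, fun m hm => by simp [hm], ?_⟩
  suffices key : ∀ G G' : Fin p → Fin p → Prop, Acyclic G → Acyclic G' →
      MarkovEquiv (IDagEdge G fun m => if m = ⟨0, hp⟩ then ∅ else {m})
        (IDagEdge G' fun m => if m = ⟨0, hp⟩ then ∅ else {m}) →
      ∀ i j, G i j → G' i j by
    intro G G' hG hG' h
    ext i j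
    exact ⟨key G G' hG hG' h i j, key G' G hG' hG (Eq.symm h) i j⟩
  intro G G' hG hG' h i j hij
  have hne : i ≠ j := by rintro rfl; exact hG _ (.single hij)
  rcases h.adj hG'.iDagEdge (i := Sum.inl i) (j := Sum.inl j) (by simpa using hne)
    (Or.inl hij) with hij' | hji'
  · exact hij'
  · exfalso
    by_cases hj : j = ⟨0, hp⟩
    · have hi : i ≠ ⟨0, hp⟩ := hj ▸ hne
      exact not_reversed_of_target_eq_singleton hG' hG h.symm (m := i) (by simp [hi]) hji' hij
    · exact not_reversed_of_target_eq_singleton hG hG' h (m := j) (by simp [hj]) hij hji'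

end CausalDiscovery
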